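/- Let p(x,y) ∈ K[x₁,...,xₙ][y] be primitive (the gcd of its coefficients in K[x₁,...,xₙ] is 1). Then for every (n+1)-tuple h₁(x₁),...,hₙ(xₙ), g(y) of non-constant univariate polynomials over K, the polynomial p(h₁(x₁),...,hₙ(xₙ), g(y)) is also primitive as an element of K[x₁,...,xₙ][y]. -/

import Mathlib

/-- The substitution `xᵢ ↦ hᵢ(xᵢ)` on multivariate polynomials. -/
noncomputable def substVars {K : Type*} [Field K] {n : ℕ} (h : Fin n → Polynomial K) :
    MvPolynomial (Fin n) K →+* MvPolynomial (Fin n) K :=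
  (MvPolynomial.aeval fun i => Polynomial.aeval (MvPolynomial.X i) (h i)).toRingHom

/-- The substitution `xᵢ ↦ hᵢ(xᵢ)`, `y ↦ g(y)` on `p ∈ K[x₁,…,xₙ][y]`. -/
noncomputable def substAll {K : Type*} [Field K] {n : ℕ} (h : Fin n → Polynomial K)
    (g : Polynomial K) (p : Polynomial (MvPolynomial (Fin n) K)) :
    Polynomial (MvPolynomial (Fin n) K) :=
  (p.map (substVars h)).comp (g.map MvPolynomial.C)

open Polynomial in
theorem aux_prime {A B : Type*} [CommRing A] [CommRing B] [IsDomain A] [IsDomain B]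
    [UniqueFactorizationMonoid A] [UniqueFactorizationMonoid B]
    (φ : A →+* B) (hinj : Function.Injective φ) (hint : φ.IsIntegral) (r : B) (hr : ¬ IsUnit r) :
    ∃ (P : Ideal B) (a : A), P.IsPrime ∧ r ∈ P ∧ ¬ IsUnit a ∧ ∀ x, φ x ∈ P → a ∣ x := by
  by_cases hr0 : r = 0
  · refine ⟨⊥, 0, Ideal.isPrime_bot, by simp [hr0], not_isUnit_zero, fun x hx => ?_⟩
    rw [Ideal.mem_bot, map_eq_zero_iff _ hinj] at hx
    simp [hx]
  obtain ⟨q, hq, hqr⟩ := WfDvdMonoid.exists_irreducible_factor hr hr0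
  have hqp : Prime q := hq.prime
  have hP : (Ideal.span {q}).IsPrime := (Ideal.span_singleton_prime hqp.ne_zero).2 hqp
  by_cases hQ : (Ideal.span {q}).comap φ = ⊥
  · refine ⟨Ideal.span {q}, 0, hP, Ideal.mem_span_singleton.2 hqr, not_isUnit_zero, fun x hx => ?_⟩
    have : x ∈ (Ideal.span {q}).comap φ := hx
    rw [hQ, Ideal.mem_bot] at this
    simp [this]
  obtain ⟨f, hfQ, hf⟩ := Ideal.IsPrime.exists_mem_prime_of_ne_bot (Ideal.comap_isPrime φ _) hQ
  refine ⟨Ideal.span {q}, f, hP, Ideal.mem_span_singleton.2 hqr, hf.not_isUnit, fun x hx => ?_⟩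
  by_contra hfx
  let _ := φ.toAlgebra
  have : Algebra.IsIntegral A B := ⟨hint⟩
  have : FaithfulSMul A B := (faithfulSMul_iff_algebraMap_injective A B).2 hinj
  have : (Ideal.span {f}).IsPrime := (Ideal.span_singleton_prime hf.ne_zero).2 hf
  have hlt : Ideal.span {f} < (Ideal.span {q}).under A := by
    refine lt_of_le_of_ne ?_ ?_
    · rw [Ideal.span_singleton_le_iff_mem]; exact hfQ
    · intro h
      apply hfx
      rw [← Ideal.mem_span_singleton, h]
      exact hx
  have : Algebra.HasGoingDown A B := inferInstance
  obtain ⟨P', hlt', hP', hover⟩ := Ideal.exists_ideal_lt_liesOver_of_lt (Ideal.span {q}) hlt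
  have hne : P' ≠ ⊥ := by
    rintro rfl
    have : f ∈ (⊥ : Ideal B).under A := hover.over ▸ Ideal.mem_span_singleton_self f
    have : φ f = 0 := this
    rw [map_eq_zero_iff _ hinj] at this
    exact hf.ne_zero this
  obtain ⟨g, hgP, hg⟩ := hP'.exists_mem_prime_of_ne_bot hne
  have h1 : q ∣ g := Ideal.mem_span_singleton.1 (hlt'.le hgP)
  have h2 : g ∣ q := (hqp.associated_of_dvd hg h1).symm.dvd
  exact hlt'.not_ge ((Ideal.span_singleton_le_iff_mem _).2 (Ideal.mem_of_dvd _ h2 hgP))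

theorem aux_inj {K : Type*} [Field K] {n : ℕ}
    (h : Fin n → Polynomial K) (hh : ∀ i, 0 < (h i).natDegree) :
    Function.Injective (substVars h) := by
  have := (MvPolynomial.algebraicIndependent_X (Fin n) K).polynomial_aeval_of_transcendental
    (f := h) (fun i => Polynomial.transcendental _ (hh i).ne' (mem_nonZeroDivisors_of_ne_zero
      (Polynomial.leadingCoeff_ne_zero.2 (by rintro h0; simpa [h0] using hh i))))
  exact this

theorem aux_int {K : Type*} [Field K] {n : ℕ}
    (h : Fin n → Polynomial K) (hh : ∀ i, 0 < (h i).natDegree) :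
    (substVars h).IsIntegral := by
  intro x
  have hC : ∀ a, substVars h (MvPolynomial.C a) = MvPolynomial.C a := fun a => by
    simp [substVars, MvPolynomial.algebraMap_eq]
  induction x using MvPolynomial.induction_on with
  | C a => rw [← hC]; exact RingHom.isIntegralElem_map _
  | add p q hp hq => exact RingHom.IsIntegralElem.add _ hp hq
  | mul_X p i hp =>
    refine RingHom.IsIntegralElem.mul _ hp ?_
    have hlc : (h i).leadingCoeff ≠ 0 := by
      rw [Polynomial.leadingCoeff_ne_zero]; rintro h0; simpa [h0] using hh i
    set u := (h i).leadingCoeff with hu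
    have hm : (Polynomial.C u⁻¹ * h i).Monic := by
      rw [mul_comm]; exact Polynomial.monic_mul_leadingCoeff_inv (Polynomial.leadingCoeff_ne_zero.1 hlc)
    refine ⟨(Polynomial.C u⁻¹ * h i).map MvPolynomial.C -
      Polynomial.C (MvPolynomial.C u⁻¹ * MvPolynomial.X i), ?_, ?_⟩
    · refine (hm.map _).sub_of_left ?_
      refine lt_of_le_of_lt Polynomial.degree_C_le ?_
      rw [hm.degree_map, ← Polynomial.natDegree_pos_iff_degree_pos,
        Polynomial.natDegree_C_mul (inv_ne_zero hlc)]
      exact hh i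
    · have hc : (substVars h).comp MvPolynomial.C = MvPolynomial.C := RingHom.ext hC
      rw [Polynomial.eval₂_sub, Polynomial.eval₂_map, hc, Polynomial.eval₂_C, map_mul, hC,
        Polynomial.eval₂_mul, Polynomial.eval₂_C, ← mul_sub]
      simp [substVars, Polynomial.aeval_def, MvPolynomial.algebraMap_eq]

/-- If `p ∈ K[x₁,…,xₙ][y]` is primitive, so is `p(h₁(x₁),…,hₙ(xₙ),g(y))`
for non-constant univariate polynomials `h₁,…,hₙ,g`. -/
theorem stmt2 {K : Type*} [Field K] {n : ℕ}
    (p : Polynomial (MvPolynomial (Fin n) K)) (hp : p.IsPrimitive)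
    (h : Fin n → Polynomial K) (hh : ∀ i, 0 < (h i).natDegree)
    (g : Polynomial K) (hg : 0 < g.natDegree) :
    (substAll h g p).IsPrimitive := by
  intro r hr
  by_contra hu
  obtain ⟨P, a, hP, hrP, ha, hdiv⟩ := aux_prime (substVars h) (aux_inj h hh) (aux_int h hh) r hu
  apply ha
  apply hp
  rw [Polynomial.C_dvd_iff_dvd_coeff]
  intro m
  apply hdiv
  let π := Ideal.Quotient.mk P
  have h0 : (substAll h g p).map π = 0 := by
    obtain ⟨c, hc⟩ := hr
    rw [hc, Polynomial.map_mul, Polynomial.map_C, Ideal.Quotient.eq_zero_iff_mem.2 hrP]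
    simp
  rw [substAll, Polynomial.map_comp, Polynomial.comp_eq_zero_iff] at h0
  rcases h0 with h0 | ⟨_, h0⟩
  · have := congrArg (fun t => Polynomial.coeff t m) h0
    simp only [Polynomial.coeff_map, Polynomial.coeff_zero] at this
    exact Ideal.Quotient.eq_zero_iff_mem.1 this
  · exfalso
    have := congrArg Polynomial.natDegree h0
    rw [Polynomial.natDegree_C, Polynomial.map_map, Polynomial.natDegree_map] at this
    omega
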